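/- For 2 < c ≤ 3, every vertex of the polytope {(P(y|x)), (λ_y) : P(y|x) ≥ 0, P(y|x) ≤ λ_y, Σ_y P(y|x) = 1, Σ_y λ_y = c} at which all λ_y > 0 has (up to permutation of outcomes) λ₁ = c−2, λ₂ = λ₃ = 1, and each column P(·|x) is one of the four distributions (0,0,1), (0,1,0), (c−2,0,3−c), (c−2,3−c,0). -/

import Mathlib

/-- The channel polytope: conditional probabilities P(y|x) together with bounds λ_y. -/
def channelPolytope (X : Type) [Fintype X] (c : ℝ) :
    Set ((X → Fin 3 → ℝ) × (Fin 3 → ℝ)) :=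
  {v | (∀ x y, 0 ≤ v.1 x y) ∧ (∀ x y, v.1 x y ≤ v.2 y) ∧
       (∀ x, ∑ y, v.1 x y = 1) ∧ (∑ y, v.2 y = c)}

open Filter Topology in
/-- A direction preserving all tight constraints at an extreme point of the channel polytope
vanishes. -/
theorem direction_eq_zero_of_extreme {X : Type} [Fintype X] {c : ℝ}
    {v : (X → Fin 3 → ℝ) × (Fin 3 → ℝ)}
    (hv : v ∈ Set.extremePoints ℝ (channelPolytope X c))
    (w : (X → Fin 3 → ℝ) × (Fin 3 → ℝ))
    (hsum : ∀ x, ∑ y, w.1 x y = 0) (hsum' : ∑ y, w.2 y = 0)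
    (hzero : ∀ x y, v.1 x y = 0 → w.1 x y = 0)
    (htop : ∀ x y, v.1 x y = v.2 y → w.1 x y = w.2 y) : w = 0 := by
  obtain ⟨⟨h0, h1, h2, h3⟩, hext⟩ := hv
  have key : ∀ᶠ ε in 𝓝 (0 : ℝ), v + ε • w ∈ channelPolytope X c := by
    have low : ∀ x y, ∀ᶠ ε in 𝓝 (0 : ℝ), 0 ≤ v.1 x y + ε * w.1 x y := by
      intro x y
      rcases (h0 x y).eq_or_lt with h | h
      · simp [← h, hzero x y h.symm]
      · have hc : ContinuousAt (fun ε : ℝ => v.1 x y + ε * w.1 x y) 0 := by fun_prop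
        filter_upwards [hc.eventually (lt_mem_nhds (a := 0) (by simpa using h))] with ε hε
        exact hε.le
    have high : ∀ x y, ∀ᶠ ε in 𝓝 (0 : ℝ), v.1 x y + ε * w.1 x y ≤ v.2 y + ε * w.2 y := by
      intro x y
      rcases (h1 x y).eq_or_lt with h | h
      · simp [h, htop x y h]
      · have hc : ContinuousAt
            (fun ε : ℝ => v.2 y + ε * w.2 y - (v.1 x y + ε * w.1 x y)) 0 := by fun_prop
        filter_upwards [hc.eventually (lt_mem_nhds (a := 0) (by simpa using h))] with ε hε
        linarith
    filter_upwards [eventually_all.2 fun x => eventually_all.2 (low x),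
      eventually_all.2 fun x => eventually_all.2 (high x)] with ε hl hh
    refine ⟨fun x y => by simpa using hl x y, fun x y => by simpa using hh x y, fun x => ?_, ?_⟩
    · simp [Finset.sum_add_distrib, ← Finset.mul_sum, h2, hsum]
    · simp [Finset.sum_add_distrib, ← Finset.mul_sum, h3, hsum']
  have hneg : Tendsto (fun ε : ℝ => -ε) (𝓝 0) (𝓝 0) := by
    simpa using (continuous_neg (G := ℝ)).tendsto 0
  obtain ⟨ε, ⟨hp, hm⟩, hε⟩ :=
    (((key.and (hneg.eventually key)).filter_mono nhdsWithin_le_nhds).and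
      (self_mem_nhdsWithin (a := (0 : ℝ)) (s := Set.Ioi 0))).exists
  have hmid : v ∈ openSegment ℝ (v + ε • w) (v + (-ε) • w) :=
    ⟨1 / 2, 1 / 2, by norm_num, by norm_num, by norm_num, by module⟩
  have := hext hp hm hmid
  simpa [(show (0 : ℝ) < ε from hε).ne'] using this

theorem sum_perm_fin_three (σ : Equiv.Perm (Fin 3)) (f : Fin 3 → ℝ) :
    ∑ y, f y = f (σ 0) + f (σ 1) + f (σ 2) := by
  rw [← Equiv.sum_comp σ f, Fin.sum_univ_three]

/-- At a vertex, each column has at most one entry strictly between its bounds. -/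
theorem not_two_free_entries {X : Type} [Fintype X] {c : ℝ}
    {v : (X → Fin 3 → ℝ) × (Fin 3 → ℝ)}
    (hv : v ∈ Set.extremePoints ℝ (channelPolytope X c)) (x : X) {y z : Fin 3} (hyz : y ≠ z) :
    v.1 x y = 0 ∨ v.1 x y = v.2 y ∨ v.1 x z = 0 ∨ v.1 x z = v.2 z := by
  classical
  by_contra! h
  obtain ⟨hy0, hy1, hz0, hz1⟩ := h
  have h := direction_eq_zero_of_extreme hv
    (Pi.single x (Pi.single y 1 - Pi.single z 1), 0) ?_ (by simp) ?_ ?_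
  · have := congrFun (congrFun (congrArg Prod.fst h) x) y
    simp [hyz] at this
  · intro x'
    rcases eq_or_ne x' x with rfl | hx <;> simp [*]
  all_goals
    intro x' y' h'
    rcases eq_or_ne x' x with rfl | hx
    · have hy : y' ≠ y := by rintro rfl; contradiction
      have hz : y' ≠ z := by rintro rfl; contradiction
      simp [hy, hz]
    · simp [hx]

/-- A column can follow the exchange of mass between the first two bounds, unless its support is
tight and the corresponding sum of bounds changes. -/
theorem exists_column_direction {a b k l m n : ℝ} (hl : 0 < l) (hm : 0 < m) (hn : 0 < n)
    (hs : a + b + k = 1) (hc : 1 < l + m + n) (hl1 : l ≠ 1) (hm1 : m ≠ 1)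
    (hln : l + n ≠ 1) (hmn : m + n ≠ 1) :
    ∃ p q r : ℝ, p + q + r = 0 ∧ (a = 0 → p = 0) ∧ (b = 0 → q = 0) ∧ (k = 0 → r = 0) ∧
      (a = l → p = 1) ∧ (b = m → q = -1) ∧ (k = n → r = 0) := by
  classical
  by_cases hk : k = 0 ∨ k = n
  · by_cases ha : a = 0 ∨ a = l
    · by_cases hb : b = 0 ∨ b = m
      · rcases hk with rfl | rfl <;> rcases ha with rfl | rfl <;> rcases hb with rfl | rfl
        all_goals first
          | (exfalso; grind)
          | exact ⟨0, 0, 0, by grind⟩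
          | exact ⟨1, -1, 0, by grind⟩
      · exact ⟨if a = l then 1 else 0, -(if a = l then 1 else 0), 0, by grind⟩
    · exact ⟨-(if b = m then -1 else 0), if b = m then -1 else 0, 0, by grind⟩
  · exact ⟨if a = l then 1 else 0, if b = m then -1 else 0,
      -((if a = l then 1 else 0) + (if b = m then -1 else 0)), by grind⟩

theorem bound_relation_of_extreme {X : Type} [Fintype X] {c : ℝ} (hc : 1 < c)
    {v : (X → Fin 3 → ℝ) × (Fin 3 → ℝ)}
    (hv : v ∈ Set.extremePoints ℝ (channelPolytope X c)) (hpos : ∀ y, 0 < v.2 y)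
    (σ : Equiv.Perm (Fin 3)) :
    v.2 (σ 0) = 1 ∨ v.2 (σ 1) = 1 ∨ v.2 (σ 0) + v.2 (σ 2) = 1 ∨ v.2 (σ 1) + v.2 (σ 2) = 1 := by
  by_contra! h
  obtain ⟨hl, hm, hln, hmn⟩ := h
  obtain ⟨-, -, h2, h3⟩ := hv.1
  rw [sum_perm_fin_three σ] at h3
  choose p q r hsum hp hq hr hp' hq' hr' using fun x =>
    exists_column_direction (hpos (σ 0)) (hpos (σ 1)) (hpos (σ 2))
      ((sum_perm_fin_three σ (v.1 x)).symm.trans (h2 x)) (h3 ▸ hc) hl hm hln hmn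
  have h := direction_eq_zero_of_extreme hv
    (fun x y => ![p x, q x, r x] (σ.symm y), fun y => ![1, -1, 0] (σ.symm y)) ?_ ?_ ?_ ?_
  · have := congrFun (congrArg Prod.snd h) (σ 0)
    simp at this
  · intro x
    simpa [sum_perm_fin_three σ] using hsum x
  · simp [sum_perm_fin_three σ]
  · intro x y
    obtain ⟨i, rfl⟩ := σ.surjective y
    fin_cases i
    · simpa using hp x
    · simpa using hq x
    · simpa using hr x
  · intro x y
    obtain ⟨i, rfl⟩ := σ.surjective y
    fin_cases i
    · simpa using hp' x
    · simpa using hq' x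
    · simpa using hr' x

theorem exists_perm_bounds_eq_one {X : Type} [Fintype X] {c : ℝ} (hc : 2 < c)
    {v : (X → Fin 3 → ℝ) × (Fin 3 → ℝ)}
    (hv : v ∈ Set.extremePoints ℝ (channelPolytope X c)) (hpos : ∀ y, 0 < v.2 y) :
    ∃ σ : Equiv.Perm (Fin 3), v.2 (σ 1) = 1 ∧ v.2 (σ 2) = 1 := by
  by_contra! h
  have rel := bound_relation_of_extreme (by linarith) hv hpos
  have a1 := rel 1
  have a2 := rel (Equiv.swap 0 2)
  have a3 := rel (Equiv.swap 1 2)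
  have b1 := h 1
  have b2 := h (Equiv.swap 0 2)
  have b3 := h (Equiv.swap 0 1)
  have e1 : (Equiv.swap (0 : Fin 3) 2) 1 = 1 := by decide
  have e2 : (Equiv.swap (1 : Fin 3) 2) 0 = 0 := by decide
  have e3 : (Equiv.swap (0 : Fin 3) 1) 2 = 2 := by decide
  simp only [Equiv.Perm.one_apply, Equiv.swap_apply_left, Equiv.swap_apply_right, e1, e2, e3]
    at a1 a2 a3 b1 b2 b3
  have hs := hv.1.2.2.2
  rw [Fin.sum_univ_three] at hs
  have p0 := hpos 0
  have p1 := hpos 1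
  have p2 := hpos 2
  grind

theorem vertex_odd_case_structure (X : Type) [Fintype X] (c : ℝ)
    (hc1 : 2 < c) (hc2 : c ≤ 3)
    (v : (X → Fin 3 → ℝ) × (Fin 3 → ℝ))
    (hv : v ∈ Set.extremePoints ℝ (channelPolytope X c))
    (hpos : ∀ y, 0 < v.2 y) :
    ∃ σ : Equiv.Perm (Fin 3),
      v.2 (σ 0) = c - 2 ∧ v.2 (σ 1) = 1 ∧ v.2 (σ 2) = 1 ∧
      ∀ x, (fun y => v.1 x (σ y)) ∈
        ({![0, 0, 1], ![0, 1, 0], ![c - 2, 0, 3 - c], ![c - 2, 3 - c, 0]} :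
          Set (Fin 3 → ℝ)) := by
  obtain ⟨σ, h1, h2⟩ := exists_perm_bounds_eq_one hc1 hv hpos
  obtain ⟨hnonneg, hle, hcol, hs⟩ := hv.1
  rw [sum_perm_fin_three σ] at hs
  have h0 : v.2 (σ 0) = c - 2 := by linarith
  refine ⟨σ, h0, h1, h2, fun x => ?_⟩
  have a := not_two_free_entries hv x (σ.injective.ne (show (0 : Fin 3) ≠ 1 by decide))
  have b := not_two_free_entries hv x (σ.injective.ne (show (0 : Fin 3) ≠ 2 by decide))
  have d := not_two_free_entries hv x (σ.injective.ne (show (1 : Fin 3) ≠ 2 by decide))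
  have s := hcol x
  rw [sum_perm_fin_three σ] at s
  have n0 := hnonneg x (σ 0)
  have n1 := hnonneg x (σ 1)
  have n2 := hnonneg x (σ 2)
  have l0 := hle x (σ 0)
  rw [h0] at a b l0
  rw [h1] at a d
  rw [h2] at b d
  simp [funext_iff, Fin.forall_fin_succ]
  grind
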